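/- arXiv:2310.11973 — 3 statements merged into one kernel-verified Lean document; each statement's English description precedes it below -/
import Mathlib

section
/- There exists an absolute constant c > 0 such that for every integer d ≥ 1, every real δ > 0 and L_f ≥ 0, and every L_f-Lipschitz function f: ℝ^d → ℝ, the smoothed function f_δ is differentiable on ℝ^d and its gradient is Lipschitz with constant L_δ = c L_f √d / δ, i.e. ‖∇f_δ(x) − ∇f_δ(y)‖ ≤ (c L_f √d / δ)‖x − y‖ for all x, y ∈ ℝ^d. -/
open MeasureTheory Metric

/-- The uniform probability measure on the closed unit Euclidean ball of `ℝ^d`. -/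
noncomputable def ballUniform (d : ℕ) : Measure (EuclideanSpace ℝ (Fin d)) :=
  (volume (closedBall (0 : EuclideanSpace ℝ (Fin d)) 1))⁻¹ •
    volume.restrict (closedBall (0 : EuclideanSpace ℝ (Fin d)) 1)


theorem aux_slab (n : ℕ) (t : ℝ) (ht : 0 ≤ t) :
    volume {x : EuclideanSpace ℝ (Fin (n+1)) | ‖x‖ ≤ 1 ∧ 1 < ‖x - EuclideanSpace.single 0 t‖} ≤
      ENNReal.ofReal t * volume (closedBall (0 : EuclideanSpace ℝ (Fin n)) 1) := by
  let T : Set (ℝ × EuclideanSpace ℝ (Fin n)) :=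
    {p | p.1 ^ 2 + ‖p.2‖ ^ 2 ≤ 1 ∧ 1 < (p.1 - t) ^ 2 + ‖p.2‖ ^ 2}
  have hT : MeasurableSet T := by
    have hTe : T = {p : ℝ × EuclideanSpace ℝ (Fin n) | p.1 ^ 2 + ‖p.2‖ ^ 2 ≤ 1} ∩
        {p | 1 < (p.1 - t) ^ 2 + ‖p.2‖ ^ 2} := by
      ext p; simp [T]
    rw [hTe]
    exact (measurableSet_le (by fun_prop) (by fun_prop)).inter
      (measurableSet_lt (by fun_prop) (by fun_prop))
  have h1 := PiLp.volume_preserving_ofLp (Fin (n+1))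
  have h2 := volume_preserving_piFinSuccAbove (fun _ : Fin (n+1) => ℝ) 0
  have h3 := (MeasurePreserving.id (volume : Measure ℝ)).prod
    (PiLp.volume_preserving_toLp (Fin n))
  have h4 := h3.comp (h2.comp h1)
  have hS : {x : EuclideanSpace ℝ (Fin (n+1)) | ‖x‖ ≤ 1 ∧ 1 < ‖x - EuclideanSpace.single 0 t‖}
      = ((Prod.map id (WithLp.toLp 2)) ∘
        (MeasurableEquiv.piFinSuccAbove (fun _ : Fin (n+1) => ℝ) 0) ∘ WithLp.ofLp) ⁻¹' T := by
    ext x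
    have e1 : ‖x‖ ≤ 1 ↔ ‖x‖ ^ 2 ≤ 1 := by
      rw [sq_le_one_iff₀ (norm_nonneg _)]
    have e2 : 1 < ‖x - EuclideanSpace.single 0 t‖ ↔ 1 < ‖x - EuclideanSpace.single 0 t‖ ^ 2 := by
      rw [one_lt_sq_iff₀ (norm_nonneg _)]
    rw [Set.mem_ofPred_eq, e1, e2]
    simp [T, EuclideanSpace.real_norm_sq_eq, Fin.sum_univ_succ,
      MeasurableEquiv.piFinSuccAbove, Fin.insertNthEquiv, Fin.removeNth, Fin.tail]
  rw [hS, h4.measure_preimage hT.nullMeasurableSet, Measure.prod_apply_symm hT]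
  calc _ ≤ ∫⁻ y, (closedBall (0 : EuclideanSpace ℝ (Fin n)) 1).indicator
        (fun _ => ENNReal.ofReal t) y := by
        apply lintegral_mono
        intro y
        by_cases hy : y ∈ closedBall (0 : EuclideanSpace ℝ (Fin n)) 1
        · rw [Set.indicator_of_mem hy]
          have hy' : ‖y‖ ≤ 1 := by simpa using hy
          set r := √(1 - ‖y‖ ^ 2)
          have hr : r ^ 2 = 1 - ‖y‖ ^ 2 := Real.sq_sqrt (by nlinarith [norm_nonneg y])
          have hr0 : 0 ≤ r := Real.sqrt_nonneg _
          have : (fun a => (a, y)) ⁻¹' T ⊆ Set.Icc (-r) (-r + t) := by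
            rintro a ⟨ha1, ha2⟩
            simp only at ha1 ha2
            have h1 : |a| ≤ r := abs_le_of_sq_le_sq (by linarith) hr0
            have h2 : r < |a - t| := by
              apply lt_of_pow_lt_pow_left₀ 2 (abs_nonneg _)
              rw [sq_abs]; linarith
            rw [abs_le] at h1
            rcases lt_abs.1 h2 with h | h
            · linarith
            · exact ⟨h1.1, by linarith⟩
          refine (measure_mono this).trans ?_
          simp
        · have hy' : 1 < ‖y‖ := by simpa using hy
          have : (fun a => (a, y)) ⁻¹' T = ∅ := by
            ext a
            simp only [T, Set.mem_preimage, Set.mem_ofPred_eq, Set.mem_empty_iff_false, iff_false]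
            rintro ⟨h, -⟩
            nlinarith [sq_nonneg a]
          beta_reduce; rw [this]; simp
    _ = _ := by
        rw [lintegral_indicator measurableSet_closedBall, setLIntegral_const]

theorem aux_vol (n : ℕ) : volume (closedBall (0 : EuclideanSpace ℝ (Fin n)) 1) =
    ENNReal.ofReal (√Real.pi ^ n / Real.Gamma (n / 2 + 1)) := by
  rcases n with _ | n
  · have : closedBall (0 : EuclideanSpace ℝ (Fin 0)) 1 = Set.univ := by
      ext x; simp [Subsingleton.elim x 0]
    rw [this, ← (PiLp.volume_preserving_toLp (Fin 0)).measure_preimage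
      MeasurableSet.univ.nullMeasurableSet]
    simp [volume_pi]
  · rw [EuclideanSpace.volume_closedBall]; simp

theorem aux_gamma (n : ℕ) : √Real.pi ^ n / Real.Gamma (n / 2 + 1) ≤
    √((n + 1 : ℕ) : ℝ) * (√Real.pi ^ (n+1) / Real.Gamma ((n + 1 : ℕ) / 2 + 1)) := by
  have hs : (0:ℝ) < n / 2 + 1 := by positivity
  have h := Real.Gamma_mul_add_mul_le_rpow_Gamma_mul_rpow_Gamma hs (t := n / 2 + 1 + 1)
    (by positivity) (a := 1/2) (b := 1/2) (by norm_num) (by norm_num) (by norm_num)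
  have hG := Real.Gamma_pos_of_pos hs
  rw [Real.Gamma_add_one hs.ne', ← Real.sqrt_eq_rpow, ← Real.sqrt_eq_rpow,
    ← Real.sqrt_mul hG.le, mul_left_comm, Real.sqrt_mul hs.le, Real.sqrt_mul_self hG.le] at h
  have e : (1 / 2 * ((n:ℝ) / 2 + 1) + 1 / 2 * (n / 2 + 1 + 1)) = ((n + 1 : ℕ) : ℝ) / 2 + 1 := by
    push_cast; ring
  rw [e] at h
  have hG' : 0 < Real.Gamma (((n + 1 : ℕ) : ℝ) / 2 + 1) := Real.Gamma_pos_of_pos (by positivity)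
  have hpi : 1 ≤ √Real.pi := Real.one_le_sqrt.2 (by linarith [Real.pi_gt_three])
  have hle : √((n:ℝ) / 2 + 1) ≤ √((n + 1 : ℕ) : ℝ) := by
    apply Real.sqrt_le_sqrt; push_cast; linarith [(Nat.cast_nonneg n : (0:ℝ) ≤ n)]
  rw [← mul_div_assoc, div_le_div_iff₀ hG hG', pow_succ]
  calc _ ≤ √Real.pi ^ n * (√((n:ℝ) / 2 + 1) * Real.Gamma (n / 2 + 1)) := by gcongr
    _ ≤ √Real.pi ^ n * (√((n + 1 : ℕ) : ℝ) * Real.Gamma (n / 2 + 1)) := by gcongr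
    _ ≤ √Real.pi ^ n * (√((n + 1 : ℕ) : ℝ) * Real.Gamma (n / 2 + 1)) * √Real.pi :=
        le_mul_of_one_le_right (by positivity) hpi
    _ = _ := by ring

theorem aux_shift (d : ℕ) (hd : 1 ≤ d) (h : EuclideanSpace ℝ (Fin d)) :
    volume.real {x : EuclideanSpace ℝ (Fin d) | ‖x‖ ≤ 1 ∧ 1 < ‖x - h‖} ≤
      ‖h‖ * √d * volume.real (closedBall (0 : EuclideanSpace ℝ (Fin d)) 1) := by
  obtain ⟨n, rfl⟩ : ∃ n, d = n + 1 := ⟨d - 1, by omega⟩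
  set w : EuclideanSpace ℝ (Fin (n+1)) := EuclideanSpace.single 0 ‖h‖ with hw
  have hhw : ‖h‖ = ‖w‖ := by simp [hw]
  let R := (ℝ ∙ (h - w))ᗮ.reflection
  have hR : R h = w := Submodule.reflection_sub hhw
  have hpre : {x : EuclideanSpace ℝ (Fin (n+1)) | ‖x‖ ≤ 1 ∧ 1 < ‖x - h‖} =
      R ⁻¹' {x | ‖x‖ ≤ 1 ∧ 1 < ‖x - w‖} := by
    ext x
    simp only [Set.mem_preimage, Set.mem_ofPred_eq]
    rw [← hR, ← map_sub, LinearIsometryEquiv.norm_map, LinearIsometryEquiv.norm_map]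
  have hm : MeasurableSet {x : EuclideanSpace ℝ (Fin (n+1)) | ‖x‖ ≤ 1 ∧ 1 < ‖x - w‖} := by
    have hTe : {x : EuclideanSpace ℝ (Fin (n+1)) | ‖x‖ ≤ 1 ∧ 1 < ‖x - w‖} =
        {x | ‖x‖ ≤ 1} ∩ {x | 1 < ‖x - w‖} := by
      ext p; simp
    rw [hTe]
    exact (measurableSet_le (by fun_prop) (by fun_prop)).inter
      (measurableSet_lt (by fun_prop) (by fun_prop))
  have key := aux_slab n ‖h‖ (norm_nonneg _)
  rw [← hw, ← R.measurePreserving.measure_preimage hm.nullMeasurableSet, ← hpre, aux_vol,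
    ← ENNReal.ofReal_mul (norm_nonneg _)] at key
  have hG (m : ℕ) : 0 ≤ √Real.pi ^ m / Real.Gamma (m / 2 + 1) :=
    div_nonneg (by positivity) (Real.Gamma_pos_of_pos (by positivity)).le
  have k2 := ENNReal.toReal_le_of_le_ofReal (mul_nonneg (norm_nonneg _) (hG n)) key
  refine k2.trans ?_
  rw [measureReal_def, aux_vol, ENNReal.toReal_ofReal (hG _), mul_assoc]
  exact mul_le_mul_of_nonneg_left (aux_gamma n) (norm_nonneg _)

theorem aux_integral (d : ℕ) (hd : 1 ≤ d)
    (K : EuclideanSpace ℝ (Fin d) → (EuclideanSpace ℝ (Fin d) →L[ℝ] ℝ))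
    (hK : Measurable K) (C : ℝ) (hC : 0 ≤ C) (hb : ∀ x, ‖K x‖ ≤ C) (h : EuclideanSpace ℝ (Fin d)) :
    ‖(∫ u in closedBall (0 : EuclideanSpace ℝ (Fin d)) 1, K u) -
      ∫ u in closedBall (0 : EuclideanSpace ℝ (Fin d)) 1, K (u + h)‖ ≤
      2 * C * ‖h‖ * √d * volume.real (closedBall (0 : EuclideanSpace ℝ (Fin d)) 1) := by
  set B := closedBall (0 : EuclideanSpace ℝ (Fin d)) 1 with hB
  set B' := closedBall h 1 with hB'
  have e1 : ∫ u in B, K (u + h) = ∫ u in B', K u := by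
    have := (measurePreserving_add_right (volume : Measure (EuclideanSpace ℝ (Fin d))) h).setIntegral_preimage_emb
      (measurableEmbedding_addRight h) K B'
    rw [← this]
    congr 2
    ext x; simp [hB, hB', dist_eq_norm]
  have hint (s : Set (EuclideanSpace ℝ (Fin d))) (hs : volume s < ⊤) : IntegrableOn K s :=
    Measure.integrableOn_of_bounded hs.ne hK.aestronglyMeasurable
      (Filter.Eventually.of_forall hb)
  have hBf : volume B < ⊤ := measure_closedBall_lt_top
  have hBf' : volume B' < ⊤ := measure_closedBall_lt_top
  have e2 := integral_inter_add_sdiff (μ := volume) (s := B) (t := B') measurableSet_closedBall (hint B hBf)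
  have e3 := integral_inter_add_sdiff (μ := volume) (s := B') (t := B) measurableSet_closedBall (hint B' hBf')
  rw [Set.inter_comm] at e3
  rw [e1, ← e2, ← e3, add_sub_add_left_eq_sub]
  have b1 : ‖∫ u in B \ B', K u‖ ≤ C * (‖h‖ * √d * volume.real B) := by
    refine (norm_setIntegral_le_of_norm_le_const
      ((measure_mono Set.sdiff_subset).trans_lt hBf) (fun x _ => hb x)).trans ?_
    gcongr
    refine le_trans (le_of_eq ?_) (aux_shift d hd h)
    congr 1; ext x; simp [hB, hB', dist_eq_norm]
  have b2 : ‖∫ u in B' \ B, K u‖ ≤ C * (‖h‖ * √d * volume.real B) := by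
    refine (norm_setIntegral_le_of_norm_le_const
      ((measure_mono Set.sdiff_subset).trans_lt hBf') (fun x _ => hb x)).trans ?_
    gcongr
    have := aux_shift d hd (-h)
    rw [norm_neg] at this
    refine le_trans (le_of_eq ?_) this
    have hp := (measurePreserving_add_right (volume : Measure (EuclideanSpace ℝ (Fin d))) h).measure_preimage
      (s := B' \ B) (measurableSet_closedBall.diff measurableSet_closedBall).nullMeasurableSet
    rw [measureReal_def, ← hp, measureReal_def]
    congr 2; ext x; simp [hB, hB', dist_eq_norm]
  refine (norm_sub_le _ _).trans ?_
  linarith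

/-- there is an absolute constant `c > 0` such that for every dimension
`d ≥ 1`, every `δ > 0`, `L_f ≥ 0`, and every `L_f`-Lipschitz `f : ℝ^d → ℝ`, the
randomized smoothing `f_δ(x) = E_{u ∼ Unif(B)}[f(x + δ u)]` is differentiable and its
gradient is `(c L_f √d / δ)`-Lipschitz. -/
theorem randomizedSmoothing_gradient_lipschitz :
    ∃ c : ℝ, 0 < c ∧
      ∀ (d : ℕ), 1 ≤ d → ∀ (δ Lf : ℝ), 0 < δ → 0 ≤ Lf →
        ∀ f : EuclideanSpace ℝ (Fin d) → ℝ,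
          (∀ x y, |f x - f y| ≤ Lf * ‖x - y‖) →
          Differentiable ℝ (fun x => ∫ u, f (x + δ • u) ∂(ballUniform d)) ∧
          ∀ x y : EuclideanSpace ℝ (Fin d),
            ‖gradient (fun x => ∫ u, f (x + δ • u) ∂(ballUniform d)) x -
              gradient (fun x => ∫ u, f (x + δ • u) ∂(ballUniform d)) y‖
              ≤ c * Lf * Real.sqrt d / δ * ‖x - y‖ := by
  refine ⟨2, by norm_num, ?_⟩
  intro d hd δ Lf hδ hLf f hf
  have hlip : LipschitzWith ⟨Lf, hLf⟩ f := by
    refine LipschitzWith.of_dist_le_mul fun x y => ?_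
    rw [Real.dist_eq, dist_eq_norm]; exact hf x y
  set B := closedBall (0 : EuclideanSpace ℝ (Fin d)) 1 with hB
  have hV0 : volume B ≠ 0 := (measure_closedBall_pos _ _ one_pos).ne'
  have hVt : volume B ≠ ⊤ := measure_closedBall_lt_top.ne
  have hVpos : 0 < volume.real B := ENNReal.toReal_pos hV0 hVt
  have hbu : ballUniform d = (volume B)⁻¹ • volume.restrict B := rfl
  have : IsFiniteMeasure (ballUniform d) := by
    rw [hbu]
    refine ⟨?_⟩
    simp [ENNReal.inv_mul_cancel hV0 hVt]
  have hcont : Continuous f := hlip.continuous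
  have hmeas : Measurable (fderiv ℝ f) := measurable_fderiv ℝ f
  have hbound (x) : ‖fderiv ℝ f x‖ ≤ Lf := norm_fderiv_le_of_lipschitz ℝ hlip
  have hder (x : EuclideanSpace ℝ (Fin d)) :
      HasFDerivAt (fun x => ∫ u, f (x + δ • u) ∂(ballUniform d))
        (∫ u, fderiv ℝ f (x + δ • u) ∂(ballUniform d)) x := by
    refine (hasFDerivAt_integral_of_dominated_loc_of_lip (s := Set.univ) (bound := fun _ => Lf)
      Filter.univ_mem ?_ ?_ ?_ ?_ (integrable_const _) ?_).2
    · exact Filter.Eventually.of_forall fun y =>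
        (by fun_prop : Continuous fun u => f (y + δ • u)).aestronglyMeasurable
    · rw [hbu]
      refine Integrable.smul_measure ?_ (ENNReal.inv_ne_top.2 hV0)
      exact ((by fun_prop : Continuous fun u => f (x + δ • u)).continuousOn).integrableOn_compact
        (isCompact_closedBall _ _)
    · exact (hmeas.comp (by fun_prop)).aestronglyMeasurable
    · refine Filter.Eventually.of_forall fun u => ?_
      refine LipschitzWith.lipschitzOnWith ?_
      refine LipschitzWith.of_dist_le_mul fun y z => ?_
      rw [Real.dist_eq, dist_eq_norm]
      refine (hf _ _).trans (le_of_eq ?_)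
      simp [abs_of_nonneg hLf]
    · have hd1 : ∀ᵐ z ∂(volume : Measure (EuclideanSpace ℝ (Fin d))), DifferentiableAt ℝ f z :=
        hlip.ae_differentiableAt
      have hq : Measure.QuasiMeasurePreserving (fun u : EuclideanSpace ℝ (Fin d) => x + δ • u)
          volume volume := by
        refine (measurePreserving_add_left volume x).quasiMeasurePreserving.comp
          (g := fun z => x + z) (f := fun u => δ • u) ?_
        refine ⟨by fun_prop, ?_⟩
        rw [Measure.map_addHaar_smul _ hδ.ne']
        exact Measure.smul_absolutelyContinuous
      have hd2 := hq.ae hd1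
      have hd3 : ∀ᵐ u ∂(ballUniform d), DifferentiableAt ℝ f (x + δ • u) := by
        rw [hbu]
        exact Measure.ae_smul_measure (ae_restrict_of_ae hd2) _
      filter_upwards [hd3] with u hu
      exact (hasFDerivAt_comp_add_right (δ • u)).2 hu.hasFDerivAt
  refine ⟨fun x => (hder x).differentiableAt, fun x y => ?_⟩
  rw [gradient, gradient, ← map_sub, LinearIsometryEquiv.norm_map, (hder x).fderiv, (hder y).fderiv,
    hbu, integral_smul_measure, integral_smul_measure, ← smul_sub, norm_smul]
  have key := aux_integral d hd (fun w => fderiv ℝ f (x + δ • w)) (hmeas.comp (by fun_prop)) Lf hLf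
    (fun _ => hbound _) (δ⁻¹ • (y - x))
  have e (u : EuclideanSpace ℝ (Fin d)) : x + δ • (u + δ⁻¹ • (y - x)) = y + δ • u := by
    rw [smul_add, smul_inv_smul₀ hδ.ne']; abel
  simp only [e] at key
  rw [norm_smul, Real.norm_of_nonneg (inv_nonneg.2 hδ.le), norm_sub_rev y x] at key
  rw [ENNReal.toReal_inv, Real.norm_of_nonneg (by positivity)]
  change (volume.real B)⁻¹ * _ ≤ _
  rw [inv_mul_le_iff₀ hVpos]
  refine key.trans (le_of_eq ?_)
  rw [← hB]
  field_simp
end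

section
/- For every x ∈ ℝ^d, the second moment of the zeroth-order estimator satisfies ∫_Ξ ∫_{S^{d−1}} ‖g(x; w, ξ)‖² d Unif(S^{d−1})(w) dμ(ξ) ≤ 16√(2π) · d · L_f². -/
open MeasureTheory Metric

lemma zo_rad {d : ℕ} (b : Fin d → ℝ) :
    ∑ η : Fin d → ℤˣ, (∑ i, (((η i : ℤˣ) : ℤ) : ℝ) * b i) ^ 2
      = (Fintype.card (Fin d → ℤˣ) : ℝ) * ∑ i, b i ^ 2 := by
  have key : ∀ i j : Fin d, ∑ η : Fin d → ℤˣ, (((η i : ℤˣ) : ℤ) : ℝ) * (((η j : ℤˣ) : ℤ) : ℝ)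
      = if i = j then (Fintype.card (Fin d → ℤˣ) : ℝ) else 0 := by
    intro i j
    split_ifs with h
    · subst h
      have : ∀ η : Fin d → ℤˣ, (((η i : ℤˣ) : ℤ) : ℝ) * (((η i : ℤˣ) : ℤ) : ℝ) = 1 := by
        intro η
        rcases Int.units_eq_one_or (η i) with h | h <;> simp [h]
      simp [this]
    · have e := Equiv.sum_comp (Equiv.mulRight (Pi.mulSingle i (-1 : ℤˣ)))
        (fun η : Fin d → ℤˣ => (((η i : ℤˣ) : ℤ) : ℝ) * (((η j : ℤˣ) : ℤ) : ℝ))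
      have h' : j ≠ i := fun h' => h h'.symm
      simp [h', Finset.sum_neg_distrib] at e
      linarith
  have : ∀ η : Fin d → ℤˣ, (∑ i, (((η i : ℤˣ) : ℤ) : ℝ) * b i) ^ 2
      = ∑ i, ∑ j, ((((η i : ℤˣ) : ℤ) : ℝ) * (((η j : ℤˣ) : ℤ) : ℝ)) * (b i * b j) := by
    intro η
    rw [sq, Finset.sum_mul_sum]
    refine Finset.sum_congr rfl fun i _ => Finset.sum_congr rfl fun j _ => by ring
  simp_rw [this]
  rw [Finset.sum_comm]
  rw [Finset.mul_sum]
  refine Finset.sum_congr rfl fun i _ => ?_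
  rw [Finset.sum_comm]
  simp_rw [← Finset.sum_mul, key]
  simp
  ring

/-- antisymmetric coefficient -/
noncomputable def zoP {d : ℕ} [NeZero d] (c : Fin d) (η : Fin d → ℤˣ) (i : Fin d) : ℝ :=
  if i < c - i then (((η i : ℤˣ) : ℤ) : ℝ) else 0

noncomputable def zoA {d : ℕ} [NeZero d] (c : Fin d) (η : Fin d → ℤˣ) (i : Fin d) : ℝ :=
  zoP c η i - zoP c η (c - i)

lemma zoA_anti {d : ℕ} [NeZero d] (c : Fin d) (η : Fin d → ℤˣ) (i : Fin d) :
    zoA c η (c - i) = - zoA c η i := by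
  simp [zoA]

lemma zoA_fix {d : ℕ} [NeZero d] (c : Fin d) (η : Fin d → ℤˣ) (i : Fin d) (h : c - i = i) :
    zoA c η i = 0 := by
  simp [zoA, h]

lemma zoA_sq {d : ℕ} [NeZero d] (c : Fin d) (η : Fin d → ℤˣ) (i : Fin d) (h : c - i ≠ i) :
    zoA c η i ^ 2 = 1 := by
  have u : ∀ j, (((η j : ℤˣ) : ℤ) : ℝ) ^ 2 = 1 := by
    intro j
    rcases Int.units_eq_one_or (η j) with h | h <;> simp [h]
  unfold zoA zoP
  rw [sub_sub_cancel]
  rcases lt_or_gt_of_ne h with h | h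
  · simp [h, not_lt.2 h.le, u]
  · simp [h, not_lt.2 h.le, u]

lemma zo_subL {d : ℕ} [NeZero d] (c : Fin d) (φ : Fin d → ℝ) : ∑ i, φ (c - i) = ∑ i, φ i :=
  Equiv.sum_comp (Equiv.subLeft c) φ

lemma zo_subR {d : ℕ} [NeZero d] (c : Fin d) (φ : Fin d → ℝ) : ∑ i, φ (i - c) = ∑ i, φ i :=
  Equiv.sum_comp (Equiv.subRight c) φ

lemma zo_sumA {d : ℕ} [NeZero d] (w g : Fin d → ℝ) :
    ∑ c : Fin d, ∑ η : Fin d → ℤˣ, (∑ i, zoA c η i * w (c - i) * g i) ^ 2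
      ≤ (Fintype.card (Fin d → ℤˣ) : ℝ) * (4 * ((∑ i, w i ^ 2) * ∑ i, g i ^ 2)) := by
  have h1 : ∀ (c : Fin d) (η : Fin d → ℤˣ), ∑ i, zoA c η i * w (c - i) * g i
      = ∑ i, (((η i : ℤˣ) : ℤ) : ℝ) *
        (if i < c - i then w (c - i) * g i - w i * g (c - i) else 0) := by
    intro c η
    have e := zo_subL c (fun i => zoP c η i * w i * g (c - i))
    simp only [sub_sub_cancel] at e
    have : ∀ i, zoA c η i * w (c - i) * g i
      = zoP c η i * w (c - i) * g i - zoP c η (c - i) * w (c - i) * g i := by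
      intro i; unfold zoA; ring
    simp_rw [this, Finset.sum_sub_distrib, e]
    rw [← Finset.sum_sub_distrib]
    refine Finset.sum_congr rfl fun i _ => ?_
    unfold zoP
    split_ifs <;> ring
  simp_rw [h1, zo_rad, ← Finset.mul_sum]
  gcongr
  calc ∑ c : Fin d, ∑ i, (if i < c - i then w (c - i) * g i - w i * g (c - i) else 0) ^ 2
      ≤ ∑ c : Fin d, ∑ i, (2 * (w (c - i) ^ 2 * g i ^ 2) + 2 * (w i ^ 2 * g (c - i) ^ 2)) := by
        gcongr with c _ i _
        split_ifs
        · nlinarith [sq_nonneg (w (c - i) * g i + w i * g (c - i))]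
        · rw [zero_pow two_ne_zero]; positivity
    _ = 4 * ((∑ i, w i ^ 2) * ∑ i, g i ^ 2) := by
        rw [Finset.sum_comm]
        simp_rw [Finset.sum_add_distrib, ← Finset.mul_sum, ← Finset.sum_mul]
        have a1 : ∀ i, ∑ c : Fin d, w (c - i) ^ 2 = ∑ c, w c ^ 2 := fun i =>
          zo_subR i (fun j => w j ^ 2)
        have a2 : ∀ i, ∑ c : Fin d, g (c - i) ^ 2 = ∑ c, g c ^ 2 := fun i =>
          zo_subR i (fun j => g j ^ 2)
        simp_rw [a1, a2, ← Finset.mul_sum, ← Finset.sum_mul]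
        ring

lemma zo_sumFix {d : ℕ} [NeZero d] (w : Fin d → ℝ) :
    ∑ c : Fin d, ∑ i, (if c - i = i then w i ^ 2 else 0) = ∑ i, w i ^ 2 := by
  rw [Finset.sum_comm]
  simp_rw [sub_eq_iff_eq_add]
  simp

lemma zo_iso {d : ℕ} (p : Fin d → Fin d) (hp : Function.Involutive p) (A B : Fin d → ℝ)
    (hA : ∀ i, A (p i) = A i) (hB : ∀ i, B (p i) = - B i) (hAB : ∀ i, A i ^ 2 + B i ^ 2 = 1) :
    ∃ R : EuclideanSpace ℝ (Fin d) ≃ₗᵢ[ℝ] EuclideanSpace ℝ (Fin d),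
      ∀ w, R w = WithLp.toLp 2 (fun i => A i * w i + B i * w (p i)) := by
  let T : EuclideanSpace ℝ (Fin d) →ₗ[ℝ] EuclideanSpace ℝ (Fin d) :=
    { toFun := fun w => WithLp.toLp 2 (fun i => A i * w i + B i * w (p i))
      map_add' := by
        intro x y; ext i; simp; ring
      map_smul' := by
        intro r x; ext i; simp; ring }
  have hT : ∀ w, ‖T w‖ = ‖w‖ := by
    intro w
    rw [EuclideanSpace.norm_eq, EuclideanSpace.norm_eq]
    congr 1
    simp only [Real.norm_eq_abs, sq_abs]
    have rp : ∀ φ : Fin d → ℝ, ∑ i, φ (p i) = ∑ i, φ i := fun φ =>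
      Equiv.sum_comp hp.toPerm φ
    have e1 := rp (fun i => B i ^ 2 * w i ^ 2)
    have e2 := rp (fun i => A i * B i * w i * w (p i))
    simp only [hA, hB, hp _] at e1 e2
    have e3 : ∑ i, A i * -B i * w (p i) * w i = - ∑ i, A i * B i * w i * w (p i) := by
      rw [← Finset.sum_neg_distrib]
      exact Finset.sum_congr rfl fun i _ => by ring
    have e4 : ∑ i, A i * B i * w i * w (p i) = 0 := by linarith
    calc ∑ i, (T w i) ^ 2 = ∑ i, (A i ^ 2 * w i ^ 2 + (-B i) ^ 2 * w (p i) ^ 2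
            + 2 * (A i * B i * w i * w (p i))) :=
          Finset.sum_congr rfl fun i _ => by simp [T]; ring
      _ = ∑ i, (A i ^ 2 * w i ^ 2 + B i ^ 2 * w i ^ 2) := by
          rw [Finset.sum_add_distrib, Finset.sum_add_distrib, e1, ← Finset.mul_sum, e4,
            Finset.sum_add_distrib]; ring
      _ = ∑ i, w i ^ 2 := Finset.sum_congr rfl fun i _ => by rw [← add_mul, hAB, one_mul]
  refine ⟨LinearIsometry.toLinearIsometryEquiv ⟨T, hT⟩ rfl, fun w => ?_⟩
  rfl

lemma zo_intg {X : Type*} [TopologicalSpace X] [MeasurableSpace X] [OpensMeasurableSpace X]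
    [SecondCountableTopology X] (m : Measure X) [IsFiniteMeasure m] (s : Set X) (hs : IsCompact s)
    (hm : ∀ᵐ x ∂m, x ∈ s) (h : X → ℝ) (hc : Continuous h) : Integrable h m := by
  obtain ⟨C, hC⟩ := hs.exists_bound_of_continuousOn hc.continuousOn
  exact Integrable.of_bound hc.aestronglyMeasurable C (hm.mono fun x hx => hC x hx)

lemma zo_int {d : ℕ} (ν : Measure (EuclideanSpace ℝ (Fin d))) [IsProbabilityMeasure ν]
    (hν : ∀ᵐ w ∂ν, ‖w‖ = 1) (h : EuclideanSpace ℝ (Fin d) → ℝ) (hc : Continuous h) :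
    Integrable h ν :=
  zo_intg ν (sphere 0 1) (isCompact_sphere 0 1) (hν.mono fun w hw => by simpa using hw) h hc

lemma zo_cs (q : ℝ → ℝ) (hq : Continuous q) :
    (∫ t in (0:ℝ)..Real.pi, q t) ^ 2 ≤ Real.pi * ∫ t in (0:ℝ)..Real.pi, q t ^ 2 := by
  set I := ∫ t in (0:ℝ)..Real.pi, q t with hI
  have hpi := Real.pi_pos
  have h0 : 0 ≤ ∫ t in (0:ℝ)..Real.pi, (Real.pi * q t - I) ^ 2 :=
    intervalIntegral.integral_nonneg hpi.le fun t _ => sq_nonneg _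
  have h1 : ∫ t in (0:ℝ)..Real.pi, (Real.pi * q t - I) ^ 2
      = Real.pi ^ 2 * (∫ t in (0:ℝ)..Real.pi, q t ^ 2) - Real.pi * I ^ 2 := by
    have : ∀ t, (Real.pi * q t - I) ^ 2
        = Real.pi ^ 2 * q t ^ 2 - (2 * Real.pi * I) * q t + I ^ 2 := fun t => by ring
    simp_rw [this]
    rw [intervalIntegral.integral_add, intervalIntegral.integral_sub,
      intervalIntegral.integral_const_mul, intervalIntegral.integral_const_mul,
      intervalIntegral.integral_const, ← hI]
    · simp; ring
    all_goals exact Continuous.intervalIntegrable (by fun_prop) _ _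
  rw [h1] at h0
  have : 0 ≤ Real.pi * (Real.pi * (∫ t in (0:ℝ)..Real.pi, q t ^ 2) - I ^ 2) := by linarith
  have := nonneg_of_mul_nonneg_right this hpi
  linarith

/-- the infinitesimal rotation -/
noncomputable def zoJ {d : ℕ} [NeZero d] (c : Fin d) (η : Fin d → ℤˣ)
    (w : EuclideanSpace ℝ (Fin d)) : EuclideanSpace ℝ (Fin d) :=
  WithLp.toLp 2 (fun i => zoA c η i * w (c - i))

/-- the rotation -/
noncomputable def zoR {d : ℕ} [NeZero d] (c : Fin d) (η : Fin d → ℤˣ) (t : ℝ)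
    (w : EuclideanSpace ℝ (Fin d)) : EuclideanSpace ℝ (Fin d) :=
  WithLp.toLp 2 (fun i => (if c - i = i then 1 else Real.cos t) * w i
    + (Real.sin t * zoA c η i) * w (c - i))

lemma zo_fixiff {d : ℕ} [NeZero d] (c i : Fin d) : (c - (c - i) = c - i) ↔ (c - i = i) := by
  rw [sub_sub_cancel]; exact eq_comm

lemma zoR_iso {d : ℕ} [NeZero d] (c : Fin d) (η : Fin d → ℤˣ) (t : ℝ) :
    ∃ R : EuclideanSpace ℝ (Fin d) ≃ₗᵢ[ℝ] EuclideanSpace ℝ (Fin d), ⇑R = zoR c η t := by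
  obtain ⟨R, hR⟩ := zo_iso (fun i => c - i) (fun i => sub_sub_cancel c i)
    (fun i => if c - i = i then 1 else Real.cos t) (fun i => Real.sin t * zoA c η i)
    (fun i => by simp only [zo_fixiff]) (fun i => by simp only [zoA_anti]; ring)
    (fun i => by
      by_cases h : c - i = i
      · simp [h, zoA_fix c η i h]
      · simp only [h, if_false, mul_pow, zoA_sq c η i h]
        rw [mul_one, Real.cos_sq_add_sin_sq])
  exact ⟨R, funext hR⟩

lemma zoR_deriv0 {d : ℕ} [NeZero d] (c : Fin d) (η : Fin d → ℤˣ) (t : ℝ)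
    (w : EuclideanSpace ℝ (Fin d)) (i : Fin d) :
    HasDerivAt (fun t => zoR c η t w i) (zoJ c η (zoR c η t w) i) t := by
  simp only [zoR, zoJ, zoA_anti, sub_sub_cancel, eq_comm (a := i) (b := c - i)]
  by_cases h : c - i = i
  · simp only [h, if_true, zoA_fix c η i h]
    simpa using hasDerivAt_const t (w.ofLp i)
  · simp only [h, if_false]
    have := ((Real.hasDerivAt_cos t).mul_const (w.ofLp i)).add
      (((Real.hasDerivAt_sin t).mul_const (zoA c η i)).mul_const (w.ofLp (c - i)))
    refine this.congr_deriv ?_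
    have := zoA_sq c η i h
    linear_combination (Real.sin t * w.ofLp i) * this

lemma zoR_deriv {d : ℕ} [NeZero d] (c : Fin d) (η : Fin d → ℤˣ) (t : ℝ)
    (w : EuclideanSpace ℝ (Fin d)) :
    HasDerivAt (fun t => zoR c η t w) (zoJ c η (zoR c η t w)) t := by
  have key : HasDerivAt (fun t => (fun i => (zoR c η t w) i)) (fun i => (zoJ c η (zoR c η t w)) i) t := by
    rw [hasDerivAt_pi]
    intro i
    exact zoR_deriv0 c η t w i
  exact (PiLp.continuousLinearEquiv 2 ℝ (fun _ : Fin d => ℝ)).symm.hasFDerivAt.comp_hasDerivAt t key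

lemma zoJ_cont {d : ℕ} [NeZero d] (c : Fin d) (η : Fin d → ℤˣ) : Continuous (zoJ c η) := by
  unfold zoJ; fun_prop

lemma zoR_cont {d : ℕ} [NeZero d] (c : Fin d) (η : Fin d → ℤˣ) :
    Continuous (fun p : ℝ × EuclideanSpace ℝ (Fin d) => zoR c η p.1 p.2) := by
  unfold zoR
  refine (PiLp.continuous_toLp 2 _).comp (continuous_pi fun i => ?_)
  split_ifs <;> fun_prop

set_option maxHeartbeats 4000000 in
lemma zo_step {d : ℕ} [NeZero d] (ν : Measure (EuclideanSpace ℝ (Fin d))) [IsProbabilityMeasure ν]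
    (hν : ∀ᵐ w ∂ν, ‖w‖ = 1)
    (hνrot : ∀ R : EuclideanSpace ℝ (Fin d) ≃ₗᵢ[ℝ] EuclideanSpace ℝ (Fin d), ν.map R = ν)
    (f : EuclideanSpace ℝ (Fin d) → ℝ) (hf : ContDiff ℝ 1 f)
    (c : Fin d) (η : Fin d → ℤˣ) :
    ∫ w, (f (zoR c η Real.pi w) - f w) ^ 2 ∂ν
      ≤ Real.pi ^ 2 * ∫ w, (fderiv ℝ f w (zoJ c η w)) ^ 2 ∂ν := by
  have hfd : Continuous (fderiv ℝ f) := hf.continuous_fderiv one_ne_zero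
  have hJ := zoJ_cont c η
  have hR := zoR_cont c η
  set Q : EuclideanSpace ℝ (Fin d) → ℝ := fun w => fderiv ℝ f w (zoJ c η w) with hQ
  have hQc : Continuous Q := hfd.clm_apply hJ
  have hRt : ∀ t, Continuous (zoR c η t) := fun t => hR.comp (by fun_prop : Continuous fun w => (t, w))
  have hRw : ∀ w, Continuous (fun t => zoR c η t w) := fun w =>
    hR.comp (by fun_prop : Continuous fun t => (t, w))
  have hQR : Continuous (fun p : ℝ × EuclideanSpace ℝ (Fin d) => Q (zoR c η p.1 p.2) ^ 2) :=
    (hQc.comp hR).pow 2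
  have hR0 : ∀ w, zoR c η 0 w = w := by
    intro w; ext i; simp [zoR]
  have ftc : ∀ w, f (zoR c η Real.pi w) - f w = ∫ t in (0:ℝ)..Real.pi, Q (zoR c η t w) := by
    intro w
    have := intervalIntegral.integral_eq_sub_of_hasDerivAt (a := 0) (b := Real.pi)
      (f := fun t => f (zoR c η t w)) (f' := fun t => Q (zoR c η t w))
      (fun t _ => by
        have h1 := (hf.differentiable one_ne_zero (zoR c η t w)).hasFDerivAt
        exact h1.comp_hasDerivAt t (zoR_deriv c η t w))
      ((hQc.comp (hRw w)).intervalIntegrable _ _)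
    rw [this, hR0]
  have pt : ∀ w, (f (zoR c η Real.pi w) - f w) ^ 2
      ≤ Real.pi * ∫ t in (0:ℝ)..Real.pi, Q (zoR c η t w) ^ 2 := by
    intro w
    rw [ftc]
    exact zo_cs _ (hQc.comp (hRw w))
  have hint : Integrable (Function.uncurry fun t w => Q (zoR c η t w) ^ 2)
      ((volume.restrict (Set.uIoc 0 Real.pi)).prod ν) := by
    haveI : IsFiniteMeasure (volume.restrict (Set.uIoc 0 Real.pi)) := by
      rw [Set.uIoc_of_le Real.pi_pos.le]; infer_instance
    refine zo_intg _ (Set.Icc 0 Real.pi ×ˢ sphere 0 1)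
      (isCompact_Icc.prod (isCompact_sphere 0 1)) ?_ _ hQR
    have h1 : ∀ᵐ t ∂(volume.restrict (Set.uIoc 0 Real.pi)), t ∈ Set.Icc 0 Real.pi := by
      filter_upwards [ae_restrict_mem measurableSet_uIoc] with t ht
      rw [Set.uIoc_of_le Real.pi_pos.le] at ht
      exact Set.Ioc_subset_Icc_self ht
    filter_upwards [Measure.quasiMeasurePreserving_fst.ae h1,
      Measure.quasiMeasurePreserving_snd.ae hν] with p hp1 hp2
    exact ⟨hp1, by simpa using hp2⟩
  have inv : ∀ t, ∫ w, Q (zoR c η t w) ^ 2 ∂ν = ∫ w, Q w ^ 2 ∂ν := by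
    intro t
    obtain ⟨R, hRR⟩ := zoR_iso c η t
    conv_rhs => rw [← hνrot R]
    have hQ2 : Continuous (fun w => Q w ^ 2) := by fun_prop
    rw [integral_map R.continuous.aemeasurable hQ2.aestronglyMeasurable, hRR]
  have swap := intervalIntegral_integral_swap hint
  simp_rw [inv] at swap
  rw [intervalIntegral.integral_const] at swap
  have hi2 : Integrable (fun w => ∫ t in (0:ℝ)..Real.pi, Q (zoR c η t w) ^ 2) ν := by
    have := hint.integral_prod_right
    simp_rw [intervalIntegral.intervalIntegral_eq_integral_uIoc]
    simpa [Real.pi_pos.le] using this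
  calc ∫ w, (f (zoR c η Real.pi w) - f w) ^ 2 ∂ν
      ≤ ∫ w, (Real.pi * ∫ t in (0:ℝ)..Real.pi, Q (zoR c η t w) ^ 2) ∂ν := by
        refine integral_mono (zo_int ν hν _ ?_) (hi2.const_mul _) pt
        have := hf.continuous
        exact ((this.comp (hRt _)).sub this).pow 2
    _ = Real.pi ^ 2 * ∫ w, Q w ^ 2 ∂ν := by
        rw [integral_const_mul, ← swap]
        simp; ring

set_option maxHeartbeats 4000000 in
lemma zo_smooth {d : ℕ} [NeZero d] (ν : Measure (EuclideanSpace ℝ (Fin d))) [IsProbabilityMeasure ν]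
    (hν : ∀ᵐ w ∂ν, ‖w‖ = 1)
    (hνrot : ∀ R : EuclideanSpace ℝ (Fin d) ≃ₗᵢ[ℝ] EuclideanSpace ℝ (Fin d), ν.map R = ν)
    (f : EuclideanSpace ℝ (Fin d) → ℝ) (hf : ContDiff ℝ 1 f) (K : ℝ) (hK : 0 ≤ K)
    (hL : ∀ x y, |f x - f y| ≤ K * ‖x - y‖) :
    d * ∫ w, (f w - f (-w)) ^ 2 ∂ν ≤ 88 * K ^ 2 := by
  have hfc := hf.continuous
  have hfd : Continuous (fderiv ℝ f) := hf.continuous_fderiv one_ne_zero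
  have step : ∀ (c : Fin d) (η : Fin d → ℤˣ), ∫ w, (f w - f (-w)) ^ 2 ∂ν
      ≤ ∫ w, (2 * Real.pi ^ 2 * (fderiv ℝ f w (zoJ c η w)) ^ 2
        + 8 * K ^ 2 * ∑ i, (if c - i = i then w i ^ 2 else 0)) ∂ν := by
    intro c η
    have hRc : Continuous (zoR c η Real.pi) :=
      (zoR_cont c η).comp (by fun_prop : Continuous fun w => (Real.pi, w))
    have hQi : Integrable (fun w => (fderiv ℝ f w (zoJ c η w)) ^ 2) ν :=
      zo_int ν hν _ ((hfd.clm_apply (zoJ_cont c η)).pow 2)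
    have hSc : Continuous (fun w : EuclideanSpace ℝ (Fin d) =>
        ∑ i, (if c - i = i then w i ^ 2 else 0)) := by
      refine continuous_finsetSum _ fun i _ => ?_
      split_ifs <;> fun_prop
    have hSi := zo_int ν hν _ hSc
    have hDi : Integrable (fun w => (f (zoR c η Real.pi w) - f w) ^ 2) ν :=
      zo_int ν hν _ (((hfc.comp hRc).sub hfc).pow 2)
    have pt : ∀ w, (f w - f (-w)) ^ 2 ≤ 2 * (f (zoR c η Real.pi w) - f w) ^ 2
        + 8 * K ^ 2 * ∑ i, (if c - i = i then w i ^ 2 else 0) := by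
      intro w
      have h1 : ‖zoR c η Real.pi w - -w‖ ^ 2 = 4 * ∑ i, (if c - i = i then w i ^ 2 else 0) := by
        rw [EuclideanSpace.norm_sq_eq, Finset.mul_sum]
        refine Finset.sum_congr rfl fun i _ => ?_
        by_cases h : c - i = i
        · simp [zoR, h]; ring
        · simp [zoR, h]
      have h2 := hL (zoR c η Real.pi w) (-w)
      have h3 : (f (zoR c η Real.pi w) - f (-w)) ^ 2 ≤ (K * ‖zoR c η Real.pi w - -w‖) ^ 2 := by
        rw [← sq_abs]; gcongr
      rw [mul_pow, h1] at h3
      nlinarith [sq_nonneg ((f (zoR c η Real.pi w) - f w) + (f (zoR c η Real.pi w) - f (-w)))]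
    calc ∫ w, (f w - f (-w)) ^ 2 ∂ν
        ≤ ∫ w, (2 * (f (zoR c η Real.pi w) - f w) ^ 2
        + 8 * K ^ 2 * ∑ i, (if c - i = i then w i ^ 2 else 0)) ∂ν :=
          integral_mono (zo_int ν hν _ (by fun_prop)) ((hDi.const_mul _).add (hSi.const_mul _)) pt
      _ ≤ _ := by
          rw [integral_add (hDi.const_mul _) (hSi.const_mul _),
            integral_add (hQi.const_mul _) (hSi.const_mul _), integral_const_mul,
            integral_const_mul (2 * Real.pi ^ 2)]
          have := zo_step ν hν hνrot f hf c η
          linarith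
  set M : ℝ := (Fintype.card (Fin d → ℤˣ) : ℝ) with hM
  have hMpos : 0 < M := by
    rw [hM]; exact_mod_cast Fintype.card_pos
  have hci : ∀ (c : Fin d) (η : Fin d → ℤˣ), Integrable (fun w : EuclideanSpace ℝ (Fin d) =>
      2 * Real.pi ^ 2 * (fderiv ℝ f w (zoJ c η w)) ^ 2
        + 8 * K ^ 2 * ∑ i, (if c - i = i then w i ^ 2 else 0)) ν := by
    intro c η
    refine zo_int ν hν _ (Continuous.add ?_ ?_)
    · exact continuous_const.mul ((hfd.clm_apply (zoJ_cont c η)).pow 2)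
    · refine continuous_const.mul (continuous_finsetSum _ fun i _ => ?_)
      split_ifs <;> fun_prop
  have tot : M * (d * ∫ w, (f w - f (-w)) ^ 2 ∂ν) ≤ M * (88 * K ^ 2) := by
    calc M * (d * ∫ w, (f w - f (-w)) ^ 2 ∂ν)
        = ∑ c : Fin d, ∑ η : Fin d → ℤˣ, ∫ w, (f w - f (-w)) ^ 2 ∂ν := by
          simp only [Finset.sum_const, Finset.card_univ, nsmul_eq_mul, Fintype.card_fin, ← hM]
          ring
      _ ≤ ∑ c : Fin d, ∑ η : Fin d → ℤˣ, ∫ w, (2 * Real.pi ^ 2 * (fderiv ℝ f w (zoJ c η w)) ^ 2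
            + 8 * K ^ 2 * ∑ i, (if c - i = i then w i ^ 2 else 0)) ∂ν :=
          Finset.sum_le_sum fun c _ => Finset.sum_le_sum fun η _ => step c η
      _ = ∫ w, ∑ c : Fin d, ∑ η : Fin d → ℤˣ, (2 * Real.pi ^ 2 * (fderiv ℝ f w (zoJ c η w)) ^ 2
            + 8 * K ^ 2 * ∑ i, (if c - i = i then w i ^ 2 else 0)) ∂ν := by
          rw [integral_finsetSum _ fun c _ => integrable_finsetSum _ fun η _ => hci c η]
          refine Finset.sum_congr rfl fun c _ => ?_
          rw [integral_finsetSum _ fun η _ => hci c η]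
      _ ≤ ∫ w, M * (88 * K ^ 2) ∂ν := by
          refine integral_mono_ae (integrable_finsetSum _ fun c _ =>
            integrable_finsetSum _ fun η _ => hci c η) (integrable_const _) ?_
          filter_upwards [hν] with w hw
          set g := (InnerProductSpace.toDual ℝ (EuclideanSpace ℝ (Fin d))).symm (fderiv ℝ f w)
            with hg
          have hgn : ‖g‖ ≤ K := by
            rw [hg, LinearIsometryEquiv.norm_map]
            refine norm_fderiv_le_of_lip' ℝ hK (Filter.Eventually.of_forall fun x => ?_)
            exact hL x w
          have hg2 : ∑ i, g i ^ 2 ≤ K ^ 2 := by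
            have : ‖g‖ ^ 2 ≤ K ^ 2 := by gcongr
            rw [EuclideanSpace.norm_sq_eq] at this
            simpa using this
          have hw2 : ∑ i, w i ^ 2 = 1 := by
            have : ‖w‖ ^ 2 = 1 := by rw [hw]; norm_num
            rw [EuclideanSpace.norm_sq_eq] at this
            simpa using this
          have hfg : ∀ (c : Fin d) (η : Fin d → ℤˣ), fderiv ℝ f w (zoJ c η w)
              = ∑ i, zoA c η i * w (c - i) * g i := by
            intro c η
            rw [← InnerProductSpace.toDual_symm_apply (𝕜 := ℝ), ← hg]
            simp [PiLp.inner_apply, zoJ]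
          have hA := zo_sumA (fun i => w i) (fun i => g i)
          have hB := zo_sumFix (fun i => w i)
          rw [← hM, hw2, one_mul] at hA
          rw [hw2] at hB
          simp only [hfg, Finset.sum_add_distrib, ← Finset.mul_sum, Finset.sum_const,
            Finset.card_univ, nsmul_eq_mul, hB, ← hM]
          have hpi : Real.pi ^ 2 ≤ 10 := by nlinarith [Real.pi_lt_d2, Real.pi_pos]
          have h4 : M * (4 * ∑ i, g i ^ 2) ≤ M * (4 * K ^ 2) := by gcongr
          have h5 := hA.trans h4
          have h6 : 2 * Real.pi ^ 2 * (∑ c : Fin d, ∑ η : Fin d → ℤˣ,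
              (∑ i, zoA c η i * w (c - i) * g i) ^ 2) ≤ 20 * (M * (4 * K ^ 2)) := by
            gcongr; linarith
          linarith
      _ = M * (88 * K ^ 2) := by simp
  exact le_of_mul_le_mul_left tot hMpos

lemma zo_moll {d : ℕ} (f : EuclideanSpace ℝ (Fin d) → ℝ) (K : ℝ) (hK : 0 ≤ K)
    (hL : ∀ x y, |f x - f y| ≤ K * ‖x - y‖) (r : ℝ) (hr : 0 < r) :
    ∃ g : EuclideanSpace ℝ (Fin d) → ℝ, ContDiff ℝ 1 g ∧
      (∀ x y, |g x - g y| ≤ K * ‖x - y‖) ∧ ∀ x, |g x - f x| ≤ K * r := by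
  have hfc : Continuous f := by
    have : LipschitzWith ⟨K, hK⟩ f := LipschitzWith.of_dist_le_mul fun x y => by
      rw [dist_eq_norm, dist_eq_norm]; exact hL x y
    exact this.continuous
  let φ : ContDiffBump (0 : EuclideanSpace ℝ (Fin d)) := ⟨r / 2, r, by positivity, by linarith⟩
  refine ⟨convolution (φ.normed volume) f (ContinuousLinearMap.lsmul ℝ ℝ) volume, ?_, ?_, ?_⟩
  · exact HasCompactSupport.contDiff_convolution_left _ φ.hasCompactSupport_normed
      (n := 1) φ.contDiff_normed hfc.locallyIntegrable
  · intro x y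
    have hi : ∀ x, Integrable (fun t => φ.normed volume t * f (x - t)) volume := by
      intro x
      refine Continuous.integrable_of_hasCompactSupport ?_ ?_
      · exact φ.continuous_normed.mul (by fun_prop)
      · exact φ.hasCompactSupport_normed.mul_right
    simp only [convolution, ContinuousLinearMap.lsmul_apply, smul_eq_mul]
    rw [← integral_sub (hi x) (hi y)]
    have := norm_integral_le_of_norm_le (μ := volume)
      (f := fun t => φ.normed volume t * f (x - t) - φ.normed volume t * f (y - t))
      (g := fun t => φ.normed volume t * (K * ‖x - y‖)) (φ.integrable_normed.mul_const _)
      (Filter.Eventually.of_forall fun t => by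
        rw [← mul_sub, norm_mul, Real.norm_of_nonneg (φ.nonneg_normed t), Real.norm_eq_abs]
        refine mul_le_mul_of_nonneg_left ?_ (φ.nonneg_normed t)
        simpa using hL (x - t) (y - t))
    rwa [integral_mul_const, φ.integral_normed, one_mul] at this
  · intro x
    refine φ.dist_normed_convolution_le hfc.aestronglyMeasurable fun y hy => ?_
    rw [Real.dist_eq]
    refine (hL y x).trans ?_
    have : ‖y - x‖ < r := by simpa [dist_eq_norm] using hy
    gcongr

lemma zo_lip {d : ℕ} [NeZero d] (ν : Measure (EuclideanSpace ℝ (Fin d))) [IsProbabilityMeasure ν]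
    (hν : ∀ᵐ w ∂ν, ‖w‖ = 1)
    (hνrot : ∀ R : EuclideanSpace ℝ (Fin d) ≃ₗᵢ[ℝ] EuclideanSpace ℝ (Fin d), ν.map R = ν)
    (f : EuclideanSpace ℝ (Fin d) → ℝ) (K : ℝ) (hK : 0 ≤ K)
    (hL : ∀ x y, |f x - f y| ≤ K * ‖x - y‖) :
    d * ∫ w, (f w - f (-w)) ^ 2 ∂ν ≤ 88 * K ^ 2 := by
  have hfc : Continuous f := by
    have : LipschitzWith ⟨K, hK⟩ f := LipschitzWith.of_dist_le_mul fun x y => by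
      rw [dist_eq_norm, dist_eq_norm]; exact hL x y
    exact this.continuous
  have hd : (0 : ℝ) < d := by exact_mod_cast Nat.pos_of_ne_zero (NeZero.ne d)
  have main : ∀ r : ℝ, 0 < r → d * ∫ w, (f w - f (-w)) ^ 2 ∂ν
      ≤ 88 * K ^ 2 + (d * (8 * K ^ 2)) * r := by
    intro r hr
    obtain ⟨g, hg1, hgL, hgf⟩ := zo_moll f K hK hL r hr
    have hgc := hg1.continuous
    have h1 := zo_smooth ν hν hνrot g hg1 K hK hgL
    have h2 : ∫ w, (f w - f (-w)) ^ 2 ∂ν ≤ ∫ w, ((g w - g (-w)) ^ 2 + 8 * K ^ 2 * r) ∂ν := by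
      refine integral_mono_ae (zo_int ν hν _ (by fun_prop)) (zo_int ν hν _ (by fun_prop)) ?_
      filter_upwards [hν] with w hw
      have n2 : ‖w - -w‖ = 2 := by
        rw [sub_neg_eq_add, ← two_smul ℝ, norm_smul, hw]; norm_num
      have a1 := hL w (-w)
      have a2 := hgL w (-w)
      rw [n2] at a1 a2
      have b1 := abs_le.1 (hgf w)
      have b2 := abs_le.1 (hgf (-w))
      have e1 : |(f w - f (-w)) - (g w - g (-w))| ≤ 2 * (K * r) := by
        rw [abs_le]; constructor <;> linarith [b1.1, b1.2, b2.1, b2.2]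
      have e2 : |(f w - f (-w)) + (g w - g (-w))| ≤ 4 * K :=
        (abs_add_le _ _).trans (by linarith)
      have e3 := mul_le_mul e1 e2 (abs_nonneg _) (by positivity)
      rw [← abs_mul] at e3
      have e4 := (le_abs_self _).trans e3
      linarith
    rw [integral_add (zo_int ν hν _ (by fun_prop)) (integrable_const _)] at h2
    simp only [integral_const, probReal_univ, one_smul] at h2
    have h3 := mul_le_mul_of_nonneg_left h2 hd.le
    linarith
  have hC : 0 ≤ d * (8 * K ^ 2) := by positivity
  refine le_of_forall_pos_le_add fun ε hε => ?_
  refine (main (ε / (d * (8 * K ^ 2) + 1)) (by positivity)).trans ?_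
  gcongr
  rw [mul_div_assoc', div_le_iff₀ (by positivity)]
  nlinarith

/-- the second moment of the zeroth-order estimator
`g(x; w, ξ) = (d/(2δ))(F(x+δw,ξ) − F(x−δw,ξ)) w`, where `w` is drawn from the
rotation-invariant probability measure `ν` on the unit sphere and `ξ ∼ μ`, satisfies
`∫_Ξ ∫_{S^{d-1}} ‖g(x;w,ξ)‖² dν(w) dμ(ξ) ≤ 16√(2π) d L_f²`. -/
theorem zerothOrder_estimator_second_moment
    (d : ℕ) (hd : 1 ≤ d) (δ Lf : ℝ) (hδ : 0 < δ) (hLf : 0 ≤ Lf)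
    {Ξ : Type*} [MeasurableSpace Ξ] (μ : Measure Ξ) [IsProbabilityMeasure μ]
    (F : EuclideanSpace ℝ (Fin d) → Ξ → ℝ)
    (hF : Measurable (Function.uncurry F))
    (L : Ξ → ℝ) (hLmeas : Measurable L) (hLnonneg : ∀ ξ, 0 ≤ L ξ)
    (hLip : ∀ᵐ ξ ∂μ, ∀ x y, |F x ξ - F y ξ| ≤ L ξ * ‖x - y‖)
    (hL2int : Integrable (fun ξ => L ξ ^ 2) μ)
    (hL2 : ∫ ξ, L ξ ^ 2 ∂μ ≤ Lf ^ 2)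
    -- `ν` is the rotation-invariant probability measure on the unit sphere `S^{d-1}`
    (ν : Measure (EuclideanSpace ℝ (Fin d))) [IsProbabilityMeasure ν]
    (hνsphere : ∀ᵐ w ∂ν, ‖w‖ = 1)
    (hνrot : ∀ R : EuclideanSpace ℝ (Fin d) ≃ₗᵢ[ℝ] EuclideanSpace ℝ (Fin d),
      ν.map R = ν) :
    ∀ x : EuclideanSpace ℝ (Fin d),
      (∫ ξ, (∫ w, ‖((d : ℝ) / (2 * δ)) • (F (x + δ • w) ξ - F (x - δ • w) ξ) • w‖ ^ 2 ∂ν) ∂μ)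
        ≤ 16 * Real.sqrt (2 * Real.pi) * d * Lf ^ 2 := by
  intro x
  haveI : NeZero d := ⟨by omega⟩
  have hd0 : (0 : ℝ) < d := by exact_mod_cast hd
  have inner : ∀ᵐ ξ ∂μ,
      (∫ w, ‖((d : ℝ) / (2 * δ)) • (F (x + δ • w) ξ - F (x - δ • w) ξ) • w‖ ^ 2 ∂ν)
        ≤ 22 * d * L ξ ^ 2 := by
    filter_upwards [hLip] with ξ hξ
    have h1 := zo_lip ν hνsphere hνrot (fun w => F (x + δ • w) ξ) (δ * L ξ)
      (mul_nonneg hδ.le (hLnonneg ξ)) (fun y z => by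
        refine (hξ _ _).trans (le_of_eq ?_)
        rw [add_sub_add_left_eq_sub, ← smul_sub, norm_smul, Real.norm_of_nonneg hδ.le]
        ring)
    simp only [smul_neg, ← sub_eq_add_neg] at h1
    have h2 : (∫ w, ‖((d : ℝ) / (2 * δ)) • (F (x + δ • w) ξ - F (x - δ • w) ξ) • w‖ ^ 2 ∂ν)
        = ((d : ℝ) / (2 * δ)) ^ 2 * ∫ w, (F (x + δ • w) ξ - F (x - δ • w) ξ) ^ 2 ∂ν := by
      rw [← integral_const_mul]
      refine integral_congr_ae ?_
      filter_upwards [hνsphere] with w hw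
      simp only [norm_smul, hw, mul_one, mul_pow, Real.norm_eq_abs, sq_abs]
    rw [h2]
    calc ((d : ℝ) / (2 * δ)) ^ 2 * ∫ w, (F (x + δ • w) ξ - F (x - δ • w) ξ) ^ 2 ∂ν
        = (d / (4 * δ ^ 2)) * (d * ∫ w, (F (x + δ • w) ξ - F (x - δ • w) ξ) ^ 2 ∂ν) := by
          field_simp; ring
      _ ≤ (d / (4 * δ ^ 2)) * (88 * (δ * L ξ) ^ 2) := by gcongr
      _ = 22 * d * L ξ ^ 2 := by field_simp; ring
  have hs : (2 : ℝ) ≤ Real.sqrt (2 * Real.pi) := by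
    apply Real.le_sqrt_of_sq_le
    nlinarith [Real.pi_gt_three]
  calc _ ≤ ∫ ξ, 22 * d * L ξ ^ 2 ∂μ :=
        integral_mono_of_nonneg
          (Filter.Eventually.of_forall fun ξ => integral_nonneg fun w => by positivity)
          (hL2int.const_mul _) inner
    _ = 22 * d * ∫ ξ, L ξ ^ 2 ∂μ := integral_const_mul _ _
    _ ≤ 22 * d * Lf ^ 2 := by gcongr
    _ ≤ 16 * Real.sqrt (2 * Real.pi) * d * Lf ^ 2 := by
        gcongr; linarith
end

section
/- Let T ≥ 1 be an integer, η > 0, and let (x^k)_{k≥0}, (y^k)_{k≥0}, (v^k)_{k≥0} be sequences in ℝ^{md}. Suppose that for every integer r ≥ 0 one has y^{rT+1} = M_r v^{rT}, where M_r is a finite product of matrices of the form A ⊗ I_d with A doubly stochastic; that for every k with rT < k < (r+1)T (some r ≥ 0) one has y^{k+1} = Ã(k)(y^k + v^k − v^{k−1}) with Ã(k) = A(k) ⊗ I_d and A(k) doubly stochastic; and that for every k ≥ 0 one has x^{k+1} = Ã(k)(x^k − η y^{k+1}) with Ã(k) of the same form. Then for all k ≥ 0: J x^{k+1} = J x^k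 − η J y^{k+1}, and J y^{k+1} = J v^k. -/
open Matrix Kronecker

/-- A real square matrix is doubly stochastic if its entries are nonnegative and
every row and every column sums to `1`. -/
def IsDoublyStochastic {m : ℕ} (A : Matrix (Fin m) (Fin m) ℝ) : Prop :=
  (∀ i j, 0 ≤ A i j) ∧ (∀ i, ∑ j, A i j = 1) ∧ (∀ j, ∑ i, A i j = 1)

/-- `J = (1/m) (1ₘ 1ₘᵀ) ⊗ I_d`, the block-averaging matrix on `ℝ^{md}`. -/
noncomputable def Jmat (m d : ℕ) : Matrix (Fin m × Fin d) (Fin m × Fin d) ℝ :=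
  (m : ℝ)⁻¹ • ((Matrix.of fun _ _ => (1 : ℝ)) ⊗ₖ (1 : Matrix (Fin d) (Fin d) ℝ))

theorem Jmat_mul_kron {m d : ℕ} {B : Matrix (Fin m) (Fin m) ℝ} (hB : IsDoublyStochastic B) :
    Jmat m d * (B ⊗ₖ (1 : Matrix (Fin d) (Fin d) ℝ)) = Jmat m d := by
  have h : (Matrix.of fun _ _ => (1 : ℝ)) * B
      = (Matrix.of fun _ _ => (1 : ℝ) : Matrix (Fin m) (Fin m) ℝ) := by
    ext i j
    simp [Matrix.mul_apply, hB.2.2 j]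
  unfold Jmat
  rw [Matrix.smul_mul, ← Matrix.mul_kronecker_mul, h, Matrix.one_mul]

theorem Jmat_mul_prod {m d : ℕ} (l : List (Matrix (Fin m) (Fin m) ℝ))
    (hl : ∀ B ∈ l, IsDoublyStochastic B) :
    Jmat m d * (l.map fun B => B ⊗ₖ (1 : Matrix (Fin d) (Fin d) ℝ)).prod = Jmat m d := by
  induction l with
  | nil => simp
  | cons B l ih =>
    rw [List.map_cons, List.prod_cons, ← Matrix.mul_assoc, Jmat_mul_kron (hl B (by simp))]
    exact ih fun C hC => hl C (by simp [hC])

/-- averaged-sequence identities for DGFM⁺.  At restart times `k = rT`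
the tracking variable is refreshed as `y^{rT+1} = M_r v^{rT}`, where `M_r` is a finite
(nonempty) product of matrices of the form `A ⊗ I_d` with `A` doubly stochastic;
in between, the usual gradient-tracking and `x` updates are used. -/
theorem dgfm_plus_average_sequences (m d T : ℕ) (hm : 0 < m) (hd : 0 < d) (hT : 1 ≤ T)
    (η : ℝ) (hη : 0 < η)
    (A : ℕ → Matrix (Fin m) (Fin m) ℝ) (hA : ∀ k, IsDoublyStochastic (A k))
    (M : ℕ → Matrix (Fin m × Fin d) (Fin m × Fin d) ℝ)
    (hM : ∀ r : ℕ, ∃ l : List (Matrix (Fin m) (Fin m) ℝ), l ≠ [] ∧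
      (∀ B ∈ l, IsDoublyStochastic B) ∧
      M r = (l.map fun B => B ⊗ₖ (1 : Matrix (Fin d) (Fin d) ℝ)).prod)
    (x y v : ℕ → (Fin m × Fin d → ℝ))
    (hrestart : ∀ r : ℕ, y (r * T + 1) = (M r).mulVec (v (r * T)))
    (hyrec : ∀ r k : ℕ, r * T < k → k < (r + 1) * T →
      y (k + 1) = (A k ⊗ₖ (1 : Matrix (Fin d) (Fin d) ℝ)).mulVec
        (y k + v k - v (k - 1)))
    (hxrec : ∀ k : ℕ,
      x (k + 1) = (A k ⊗ₖ (1 : Matrix (Fin d) (Fin d) ℝ)).mulVec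
        (x k - η • y (k + 1))) :
    ∀ k : ℕ,
      (Jmat m d).mulVec (x (k + 1)) =
          (Jmat m d).mulVec (x k) - η • (Jmat m d).mulVec (y (k + 1)) ∧
      (Jmat m d).mulVec (y (k + 1)) = (Jmat m d).mulVec (v k) := by
  have hy : ∀ k, (Jmat m d).mulVec (y (k + 1)) = (Jmat m d).mulVec (v k) := by
    intro k
    induction k with
    | zero =>
      obtain ⟨l, -, hl, hMl⟩ := hM 0
      have h := hrestart 0
      rw [Nat.zero_mul] at h
      rw [h, Matrix.mulVec_mulVec, hMl, Jmat_mul_prod l hl]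
    | succ k ih =>
      have hdm := Nat.div_add_mod (k + 1) T
      have hlt := Nat.mod_lt (k + 1) hT
      rw [Nat.mul_comm] at hdm
      generalize (k + 1) / T = r at hdm
      rcases Nat.eq_zero_or_pos ((k + 1) % T) with h0 | h0
      · have hk : k + 1 = r * T := by omega
        obtain ⟨l, -, hl, hMl⟩ := hM r
        rw [hk, hrestart r, Matrix.mulVec_mulVec, hMl, Jmat_mul_prod l hl]
      · rw [hyrec r (k + 1) (by omega) (by rw [Nat.add_mul]; omega), Matrix.mulVec_mulVec,
          Jmat_mul_kron (hA _), Matrix.mulVec_sub, Matrix.mulVec_add, ih, Nat.add_sub_cancel]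
        abel
  intro k
  refine ⟨?_, hy k⟩
  rw [hxrec k, Matrix.mulVec_mulVec, Jmat_mul_kron (hA _), Matrix.mulVec_sub, Matrix.mulVec_smul]
end
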